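/- (Theorem 1, special case π = id) Let n ≥ 2 and let x = (x₁, …, x_{n²})ᵀ ∈ ℤ^{n²} with 1 ≤ x_i ≤ n for i = 1, …, n² and A x <> 0, where A is the block-diagonal matrix built from A(n). Then 2x = Aᵀ sgn(A x) + (n+1)·1_{n²}, where 1_{n²} is the all-ones vector in ℤ^{n²}. -/

import Mathlib

open Matrix

/-- The difference matrix `A(n)`: rows are indexed by pairs `(i, j)` with `i < j`,
row `(i, j)` has entry `+1` in column `i`, entry `-1` in column `j`, and `0` elsewhere. -/
def Amat (n : ℕ) : Matrix {p : Fin n × Fin n // p.1 < p.2} (Fin n) ℤ :=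
  fun p k => if k = p.val.1 then 1 else if k = p.val.2 then -1 else 0

/-- The `(n·s(n)) × n²` block-diagonal matrix `A` with `n` copies of `A(n)` along the
diagonal and zeros elsewhere.  Columns are indexed by `Fin (n * n)` in the row-major
layout `(r, j) ↦ r·n + j` given by `finProdFinEquiv`. -/
def bigA (n : ℕ) : Matrix (Fin n × {p : Fin n × Fin n // p.1 < p.2}) (Fin (n * n)) ℤ :=
  fun r c =>
    if (finProdFinEquiv.symm c).1 = r.1 then Amat n r.2 (finProdFinEquiv.symm c).2 else 0

/-- `A_π`: the matrix `A` with columns permuted by `π`, i.e. the `j`-th column of `A_π`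
is the `π⁻¹(j)`-th column of `A`. -/
def Aperm (n : ℕ) (π : Equiv.Perm (Fin (n * n))) :
    Matrix (Fin n × {p : Fin n × Fin n // p.1 < p.2}) (Fin (n * n)) ℤ :=
  (bigA n).submatrix id ⇑π.symm

theorem Amat_apply (n : ℕ) (p : {p : Fin n × Fin n // p.1 < p.2}) (k : Fin n) :
    Amat n p k = (if k = p.val.1 then 1 else 0) - (if k = p.val.2 then 1 else 0) := by
  have hp := p.property.ne
  unfold Amat
  grind

theorem Amat_mulVec (n : ℕ) (y : Fin n → ℤ) (p : {p : Fin n × Fin n // p.1 < p.2}) :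
    (Amat n *ᵥ y) p = y p.val.1 - y p.val.2 := by
  simp [mulVec, dotProduct, Amat_apply, sub_mul, Finset.sum_sub_distrib]

/-- On an antisymmetric family, the transpose of `A(n)` computes row sums. -/
theorem Amat_transpose_mulVec_of_antisymm (n : ℕ) (g : Fin n → Fin n → ℤ)
    (hg : ∀ i j, g i j = -g j i) (k : Fin n) :
    ((Amat n)ᵀ *ᵥ fun p => g p.val.1 p.val.2) k = ∑ j, g k j := by
  have hsum : ((Amat n)ᵀ *ᵥ fun p => g p.val.1 p.val.2) k =
      ∑ i, ∑ j, if i < j then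
        ((if k = i then 1 else 0) - (if k = j then 1 else 0)) * g i j else 0 := by
    simp only [mulVec, dotProduct, transpose_apply, Amat_apply]
    rw [← Fintype.sum_prod_type' (f := fun i j : Fin n => if i < j then
        ((if k = i then 1 else 0) - (if k = j then 1 else 0)) * g i j else 0),
      ← Finset.sum_filter]
    exact (Finset.sum_subtype _ (by simp) (fun p : Fin n × Fin n =>
      ((if k = p.1 then 1 else 0) - (if k = p.2 then 1 else 0)) * g p.1 p.2)).symm
  have hsplit : ∀ i j : Fin n, (if i < j then
        ((if k = i then 1 else 0) - (if k = j then 1 else 0)) * g i j else 0) =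
      (if k = i then (if k < j then g k j else 0) else 0) -
        (if k = j then (if i < k then g i k else 0) else 0) := by
    intro i j
    grind
  simp only [hsum, hsplit, Finset.sum_sub_distrib]
  rw [Finset.sum_comm]
  simp only [Finset.sum_ite_eq, Finset.mem_univ, if_true]
  rw [← Finset.sum_sub_distrib]
  refine Finset.sum_congr rfl fun j _ => ?_
  have h1 := hg j k
  have h2 := hg k k
  rcases lt_trichotomy k j with h | rfl | h
  · simp [h, h.not_gt]
  · simp only [lt_irrefl, if_false]
    omega
  · simp [h, h.not_gt, h1]

theorem bigA_mulVec (n : ℕ) (x : Fin (n * n) → ℤ) (r : Fin n)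
    (p : {p : Fin n × Fin n // p.1 < p.2}) :
    (bigA n *ᵥ x) (r, p) = (Amat n *ᵥ fun j => x (finProdFinEquiv (r, j))) p := by
  simp only [mulVec, dotProduct, bigA]
  rw [← finProdFinEquiv.sum_comp, Fintype.sum_prod_type]
  simp only [Equiv.symm_apply_apply]
  rw [Finset.sum_eq_single r (fun s _ hs => by simp [hs]) (by simp)]
  simp

theorem bigA_transpose_mulVec (n : ℕ)
    (z : Fin n × {p : Fin n × Fin n // p.1 < p.2} → ℤ) (r k : Fin n) :
    ((bigA n)ᵀ *ᵥ z) (finProdFinEquiv (r, k)) = ((Amat n)ᵀ *ᵥ fun p => z (r, p)) k := by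
  simp only [mulVec, dotProduct, bigA, transpose_apply, Equiv.symm_apply_apply]
  rw [Fintype.sum_prod_type, Finset.sum_eq_single r (fun s _ hs => by simp [hs.symm]) (by simp)]
  simp

theorem sum_range_sign_sub (a : ℤ) (ha : 1 ≤ a) (n : ℕ) :
    ∑ i ∈ Finset.range n, Int.sign (a - ((i : ℤ) + 1)) =
      if a ≤ n then 2 * a - n - 1 else (n : ℤ) := by
  induction n with
  | zero => simp; omega
  | succ m ih =>
    rw [Finset.sum_range_succ, ih]
    push_cast
    rcases lt_trichotomy (a - ((m : ℤ) + 1)) 0 with h | h | h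
    · rw [Int.sign_eq_neg_one_of_neg h]
      split_ifs <;> omega
    · rw [h, Int.sign_zero]
      split_ifs <;> omega
    · rw [Int.sign_eq_one_of_pos h]
      split_ifs <;> omega

/-- An injective `y : Fin n → ℤ` with values in `[1, n]` takes every value exactly once. -/
theorem sum_comp_of_injective_of_mem_Icc {n : ℕ} (y : Fin n → ℤ) (hy : Function.Injective y)
    (hb : ∀ i, 1 ≤ y i ∧ y i ≤ (n : ℤ)) (f : ℤ → ℤ) :
    ∑ j, f (y j) = ∑ i ∈ Finset.range n, f ((i : ℤ) + 1) := by
  let e : Fin n → Fin n := fun j => ⟨(y j - 1).toNat, by have := hb j; omega⟩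
  have he : ∀ j, ((e j : ℕ) : ℤ) + 1 = y j := fun j => by
    have := hb j
    simp only [e]
    omega
  have hinj : Function.Injective e := fun i j hij => hy (by rw [← he i, ← he j, hij])
  rw [Finset.sum_range (fun i : ℕ => f ((i : ℤ) + 1)),
    ← (Finite.injective_iff_bijective.mp hinj).sum_comp (fun i : Fin n => f (((i : ℕ) : ℤ) + 1))]
  simp only [he]

/-- Theorem 1 for `π = id`: if `1 ≤ xᵢ ≤ n` for all `i` and `A x <> 0`, then
`2x = Aᵀ sgn(A x) + (n+1)·1_{n²}`. -/
theorem two_smul_eq_bigA_transpose_mulVec_sign (n : ℕ) (hn : 2 ≤ n)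
    (x : Fin (n * n) → ℤ)
    (hb : ∀ i, 1 ≤ x i ∧ x i ≤ (n : ℤ))
    (hx : ∀ p, (bigA n *ᵥ x) p ≠ 0) :
    (2 : ℤ) • x =
      ((bigA n)ᵀ *ᵥ fun p => Int.sign ((bigA n *ᵥ x) p)) +
        ((n : ℤ) + 1) • (1 : Fin (n * n) → ℤ) := by
  funext c
  obtain ⟨⟨r, k⟩, rfl⟩ := finProdFinEquiv.surjective c
  let y : Fin n → ℤ := fun j => x (finProdFinEquiv (r, j))
  have hne : ∀ i j, i < j → y i ≠ y j := fun i j hij h =>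
    hx (r, ⟨(i, j), hij⟩) (by rw [bigA_mulVec, Amat_mulVec]; exact sub_eq_zero.mpr h)
  have hy : Function.Injective y := fun i j h => by
    by_contra hij
    rcases lt_or_gt_of_ne hij with hlt | hlt
    · exact hne i j hlt h
    · exact hne j i hlt h.symm
  have hanti : ∀ i j, Int.sign (y i - y j) = -Int.sign (y j - y i) := fun i j => by
    rw [← Int.sign_neg, neg_sub]
  have hA : ((bigA n)ᵀ *ᵥ fun p => Int.sign ((bigA n *ᵥ x) p)) (finProdFinEquiv (r, k)) =
      2 * y k - n - 1 := by
    simp only [bigA_transpose_mulVec, bigA_mulVec, Amat_mulVec]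
    rw [Amat_transpose_mulVec_of_antisymm n (fun i j => Int.sign (y i - y j)) hanti k,
      sum_comp_of_injective_of_mem_Icc y hy (fun j => hb _) (fun v => Int.sign (y k - v)),
      sum_range_sign_sub _ (hb _).1, if_pos (hb _).2]
  simp only [Pi.add_apply, Pi.smul_apply, Pi.one_apply, smul_eq_mul, hA, y]
  ring
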